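/- arXiv:1604.07681 — 4 statements merged into one kernel-verified Lean document; each statement's English description precedes it below -/
import Mathlib

section
/- Let W ≥ 1, f : Fin W → ℝ, and let w : Fin (W−1) → ℝ satisfy w_x ≥ 0 for all x. Suppose z : Fin W → ℝ and edge variables s : Fin (W−1) → ℝ (with the boundary convention s_0 = s_W = 0, i.e. the terms s_{x−1} and s_x are read as 0 when the index is out of range) satisfy: (a) z_x = f_x + s_x − s_{x−1} for every x ∈ Fin W; (b) |s_x| ≤ w_x for every edge x; (c) for every edge x, if z_{x+1} > z_x then s_x = w_x, and if z_{x+1} < z_x then s_x = −w_x. Then z is the unique global minimizer of the primal functional P(z) = (1/2) Σ_{x ∈ Fin W} (z_x − f_x)² + Σ_{x ∈ Fin (W−1)} w_x |z_{x+1} − z_x|. -/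
open Finset

/-- 1D forward difference: `(D z)_x = z_{x+1} - z_x`. -/
def fdiff {W : ℕ} (z : Fin W → ℝ) (x : Fin (W - 1)) : ℝ :=
  z ⟨x.val + 1, by have := x.isLt; omega⟩ - z ⟨x.val, by have := x.isLt; omega⟩

/-- Edge variables extended by `0` outside the index range `{0, …, W-2}`. -/
def sExt {W : ℕ} (s : Fin (W - 1) → ℝ) (i : ℤ) : ℝ :=
  if h : 0 ≤ i ∧ i < (W : ℤ) - 1 then s ⟨i.toNat, by omega⟩ else 0

/-- `sExt s` agrees with `s` on the index range. -/
theorem sExt_natCast {n : ℕ} (s : Fin (n + 1 - 1) → ℝ) (i : Fin n) :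
    sExt s (i.val : ℤ) = s i := by
  have hi := i.isLt
  have h : (0 : ℤ) ≤ (i.val : ℤ) ∧ (i.val : ℤ) < ((n + 1 : ℕ) : ℤ) - 1 := by omega
  rw [sExt, dif_pos h]
  rfl

/-- Summation by parts: the backward difference of `sExt s` is `-Dᵀ s`. -/
theorem sum_sExt_sub_mul {W : ℕ} (s : Fin (W - 1) → ℝ) (d : Fin W → ℝ) :
    ∑ x : Fin W, (sExt s (x.val : ℤ) - sExt s ((x.val : ℤ) - 1)) * d x =
      -∑ x, s x * fdiff d x := by
  cases W with
  | zero => simp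
  | succ n =>
    have hleft : ∑ x : Fin (n + 1), sExt s (x.val : ℤ) * d x =
        ∑ i : Fin n, s i * d i.castSucc := by
      have hlast : sExt s (n : ℤ) = 0 := dif_neg (by omega)
      rw [Fin.sum_univ_castSucc]
      simp [hlast, sExt_natCast]
    have hright : ∑ x : Fin (n + 1), sExt s ((x.val : ℤ) - 1) * d x =
        ∑ i : Fin n, s i * d i.succ := by
      have hfirst : sExt s (-1) = 0 := dif_neg (by omega)
      rw [Fin.sum_univ_succ]
      simp [hfirst, sExt_natCast]
    have hdiff : ∑ x, s x * fdiff d x =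
        ∑ i : Fin n, s i * d i.succ - ∑ i : Fin n, s i * d i.castSucc := by
      rw [← Finset.sum_sub_distrib]
      exact Finset.sum_congr rfl fun i _ => mul_sub _ _ _
    simp only [sub_mul, Finset.sum_sub_distrib]
    rw [hleft, hright, hdiff]
    ring

theorem stmt_6 (W : ℕ) (hW : 1 ≤ W) (f : Fin W → ℝ)
    (w : Fin (W - 1) → ℝ) (hw : ∀ x, 0 ≤ w x)
    (z : Fin W → ℝ) (s : Fin (W - 1) → ℝ)
    -- (a) stationarity: z_x = f_x + s_x − s_{x−1}
    (ha : ∀ x : Fin W, z x = f x + sExt s (x.val : ℤ) - sExt s ((x.val : ℤ) - 1))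
    -- (b) box constraint: |s_x| ≤ w_x
    (hb : ∀ x : Fin (W - 1), |s x| ≤ w x)
    -- (c) subgradient condition
    (hc : ∀ x : Fin (W - 1),
      (z ⟨x.val + 1, by have := x.isLt; omega⟩ > z ⟨x.val, by have := x.isLt; omega⟩ →
        s x = w x) ∧
      (z ⟨x.val + 1, by have := x.isLt; omega⟩ < z ⟨x.val, by have := x.isLt; omega⟩ →
        s x = -w x)) :
    -- z is the unique global minimizer of P
    ∀ z' : Fin W → ℝ, z' ≠ z →
      (1 / 2) * (∑ x, (z x - f x) ^ 2) + (∑ x, w x * |fdiff z x|) <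
        (1 / 2) * (∑ x, (z' x - f x) ^ 2) + (∑ x, w x * |fdiff z' x|) := by
  intro z' hne
  have hedge (x : Fin (W - 1)) :
      w x * |fdiff z x| + s x * fdiff (fun y => z' y - z y) x ≤ w x * |fdiff z' x| := by
    have hsub : fdiff (fun y => z' y - z y) x = fdiff z' x - fdiff z x := by
      simp only [fdiff]
      ring
    have hbound : s x * fdiff z' x ≤ w x * |fdiff z' x| :=
      (le_abs_self _).trans
        (abs_mul (s x) _ ▸ mul_le_mul_of_nonneg_right (hb x) (abs_nonneg _))
    have hattained : s x * fdiff z x = w x * |fdiff z x| := by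
      rcases lt_trichotomy (fdiff z x) 0 with h | h | h
      · rw [(hc x).2 (sub_neg.mp h), abs_of_neg h]
        ring
      · simp [h]
      · rw [(hc x).1 (sub_pos.mp h), abs_of_pos h]
    rw [hsub, mul_sub]
    linarith
  have hsum := Finset.sum_le_sum fun x (_ : x ∈ Finset.univ) => hedge x
  rw [Finset.sum_add_distrib] at hsum
  have hparts := sum_sExt_sub_mul s fun y => z' y - z y
  have hexpand : ∑ x, (z' x - f x) ^ 2 = ∑ x, (z x - f x) ^ 2 + ∑ x, (z' x - z x) ^ 2 +
      2 * ∑ x : Fin W,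
        (sExt s (x.val : ℤ) - sExt s ((x.val : ℤ) - 1)) * (z' x - z x) := by
    rw [Finset.mul_sum, ← Finset.sum_add_distrib, ← Finset.sum_add_distrib]
    refine Finset.sum_congr rfl fun x _ => ?_
    rw [show sExt s (x.val : ℤ) - sExt s ((x.val : ℤ) - 1) = z x - f x by linarith [ha x]]
    ring
  have hpos : 0 < ∑ x, (z' x - z x) ^ 2 := by
    obtain ⟨x, hx⟩ := Function.ne_iff.mp hne
    exact Finset.sum_pos' (fun _ _ => sq_nonneg _)
      ⟨x, Finset.mem_univ x, sq_pos_of_ne_zero (sub_ne_zero.mpr hx)⟩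
  linarith
end

section
/- Let W ≥ 1, f : Fin W → ℝ, and let w : Fin (W−1) → ℝ satisfy w_x ≥ 0 for all x. Consider the dual problem: minimize Dual(s) = (1/2) Σ_{x ∈ Fin W} (f_x + s_x − s_{x−1})² over the compact convex feasible set C = { s : Fin (W−1) → ℝ : |s_x| ≤ w_x for all x } (with the boundary convention that s_{x−1} and s_x are read as 0 when the index is out of range). Then a global minimizer s* of Dual over C exists, and the signal z* : Fin W → ℝ defined by z*_x = f_x + s*_x − s*_{x−1} is the unique global minimizer of the primal functional P(z) = (1/2) Σ_{x ∈ Fin W} (z_x − f_x)² + Σ_{x ∈ Fin (W−1)} w_x |z_{x+1} − z_x|. -/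
open Finset

/-- Dual objective `Dual(s) = (1/2) Σ_x (f_x + s_x − s_{x−1})²`. -/
noncomputable def dualObj {W : ℕ} (f : Fin W → ℝ) (s : Fin (W - 1) → ℝ) : ℝ :=
  (1 / 2) * ∑ x : Fin W, (f x + sExt s (x.val : ℤ) - sExt s ((x.val : ℤ) - 1)) ^ 2

/-- Primal objective `P(z) = (1/2) Σ_x (z_x − f_x)² + Σ_x w_x |z_{x+1} − z_x|`. -/
noncomputable def primalObj {W : ℕ} (f : Fin W → ℝ) (w : Fin (W - 1) → ℝ)
    (z : Fin W → ℝ) : ℝ :=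
  (1 / 2) * (∑ x, (z x - f x) ^ 2) + ∑ x, w x * |fdiff z x|

/-- The negative adjoint of the forward difference: `s ↦ s_x − s_{x−1}`. -/
def edgeDiv {W : ℕ} (s : Fin (W - 1) → ℝ) (x : Fin W) : ℝ :=
  sExt s (x.val : ℤ) - sExt s ((x.val : ℤ) - 1)

lemma sExt_add_mul_sub {W : ℕ} (s r : Fin (W - 1) → ℝ) (t : ℝ) (i : ℤ) :
    sExt (fun x => s x + t * (r x - s x)) i = sExt s i + t * (sExt r i - sExt s i) := by
  unfold sExt
  split_ifs <;> simp

lemma continuous_sExt {W : ℕ} (i : ℤ) : Continuous fun s : Fin (W - 1) → ℝ => sExt s i := by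
  unfold sExt
  split_ifs <;> fun_prop

lemma continuous_dualObj {W : ℕ} (f : Fin W → ℝ) : Continuous (dualObj f) := by
  unfold dualObj
  have := @continuous_sExt W
  fun_prop

lemma exists_dualObj_minimizer {W : ℕ} (f : Fin W → ℝ) (w : Fin (W - 1) → ℝ)
    (hw : ∀ x, 0 ≤ w x) :
    ∃ s : Fin (W - 1) → ℝ, (∀ x, |s x| ≤ w x) ∧
      ∀ r : Fin (W - 1) → ℝ, (∀ x, |r x| ≤ w x) → dualObj f s ≤ dualObj f r := by
  have mem_iff (s : Fin (W - 1) → ℝ) : s ∈ Set.Icc (-w) w ↔ ∀ x, |s x| ≤ w x := by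
    simp [Set.mem_Icc, Pi.le_def, abs_le, forall_and]
  obtain ⟨s, hs, hmin⟩ := (isCompact_Icc (a := -w) (b := w)).exists_isMinOn
    ⟨0, (mem_iff 0).2 (by simpa using hw)⟩ (continuous_dualObj f).continuousOn
  exact ⟨s, (mem_iff s).1 hs, fun r hr => hmin ((mem_iff r).2 hr)⟩

/-- Summation by parts. -/
lemma sum_mul_edgeDiv {W : ℕ} (hW : 1 ≤ W) (u : Fin W → ℝ) (s : Fin (W - 1) → ℝ) :
    ∑ x, u x * edgeDiv s x = -∑ x, s x * fdiff u x := by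
  obtain ⟨n, rfl⟩ : ∃ n, W = n + 1 := ⟨W - 1, by omega⟩
  have left : ∑ x : Fin (n + 1), u x * sExt s (x.val : ℤ) =
      ∑ x : Fin n, u x.castSucc * s x := by
    rw [Fin.sum_univ_castSucc]
    simp [sExt]
  have right : ∑ x : Fin (n + 1), u x * sExt s ((x.val : ℤ) - 1) =
      ∑ x : Fin n, u x.succ * s x := by
    rw [Fin.sum_univ_succ]
    simp [sExt]
  simp only [edgeDiv, mul_sub, Finset.sum_sub_distrib, left, right]
  change _ = -∑ x : Fin n, s x * (u x.succ - u x.castSucc)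
  simp only [mul_comm (s _), sub_mul, Finset.sum_sub_distrib, neg_sub]

lemma nonneg_of_forall_mul_add_sq_nonneg {a b : ℝ} (hb : 0 ≤ b)
    (h : ∀ t : ℝ, 0 ≤ t → t ≤ 1 → 0 ≤ t * a + t ^ 2 / 2 * b) : 0 ≤ a := by
  by_contra! ha
  have hba : 0 < b - a := by linarith
  have key := h (-a / (b - a)) (div_nonneg (by linarith) hba.le)
    ((div_le_one hba).2 (by linarith))
  have : -a / (b - a) * a + (-a / (b - a)) ^ 2 / 2 * b =
      a ^ 2 * (2 * a - b) / (2 * (b - a) ^ 2) := by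
    field_simp
    ring
  rw [this] at key
  have : a ^ 2 * (2 * a - b) / (2 * (b - a) ^ 2) < 0 :=
    div_neg_of_neg_of_pos
      (mul_neg_of_pos_of_neg (sq_pos_of_neg ha) (by linarith)) (by positivity)
  linarith

/-- The variational inequality at a minimizer of the dual objective over the box. -/
lemma sum_mul_edgeDiv_le_of_minimizer {W : ℕ} {f : Fin W → ℝ} {w s : Fin (W - 1) → ℝ}
    (hs : ∀ x, |s x| ≤ w x)
    (hmin : ∀ r : Fin (W - 1) → ℝ, (∀ x, |r x| ≤ w x) → dualObj f s ≤ dualObj f r)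
    {r : Fin (W - 1) → ℝ} (hr : ∀ x, |r x| ≤ w x) :
    ∑ x, (f x + edgeDiv s x) * edgeDiv s x ≤ ∑ x, (f x + edgeDiv s x) * edgeDiv r x := by
  rw [← sub_nonneg]
  refine nonneg_of_forall_mul_add_sq_nonneg
    (b := ∑ x, (edgeDiv r x - edgeDiv s x) ^ 2) (by positivity) fun t ht0 ht1 => ?_
  have feas : ∀ x, |s x + t * (r x - s x)| ≤ w x := fun x => by
    have h1 := abs_le.1 (hs x)
    have h2 := abs_le.1 (hr x)
    rw [abs_le]
    constructor <;> nlinarith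
  have expand : dualObj f (fun x => s x + t * (r x - s x)) - dualObj f s =
      t * (∑ x, (f x + edgeDiv s x) * edgeDiv r x - ∑ x, (f x + edgeDiv s x) * edgeDiv s x) +
        t ^ 2 / 2 * ∑ x, (edgeDiv r x - edgeDiv s x) ^ 2 := by
    simp only [dualObj, sExt_add_mul_sub, edgeDiv, Finset.mul_sum, ← Finset.sum_sub_distrib,
      ← Finset.sum_add_distrib]
    exact Finset.sum_congr rfl fun x _ => by ring
  linarith [hmin _ feas]

/-- At a dual minimizer, `s` attains the weighted total variation of the recovered signal. -/
lemma sum_weight_mul_abs_fdiff_le {W : ℕ} (hW : 1 ≤ W) {f : Fin W → ℝ}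
    {w s : Fin (W - 1) → ℝ} (hw : ∀ x, 0 ≤ w x) (hs : ∀ x, |s x| ≤ w x)
    (hmin : ∀ r : Fin (W - 1) → ℝ, (∀ x, |r x| ≤ w x) → dualObj f s ≤ dualObj f r) :
    ∑ x, w x * |fdiff (fun x => f x + edgeDiv s x) x| ≤
      ∑ x, s x * fdiff (fun x => f x + edgeDiv s x) x := by
  set z : Fin W → ℝ := fun x => f x + edgeDiv s x with hz
  let r : Fin (W - 1) → ℝ := fun x => if 0 ≤ fdiff z x then w x else -w x
  have hr : ∀ x, |r x| ≤ w x := fun x => by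
    simp only [r]
    split_ifs <;> simp [abs_of_nonneg (hw x)]
  have hrz : ∑ x, r x * fdiff z x = ∑ x, w x * |fdiff z x| :=
    Finset.sum_congr rfl fun x _ => by
      simp only [r]
      split_ifs with h
      · rw [abs_of_nonneg h]
      · rw [abs_of_neg (not_le.1 h)]
        ring
  have key : ∑ x, z x * edgeDiv s x ≤ ∑ x, z x * edgeDiv r x :=
    sum_mul_edgeDiv_le_of_minimizer hs hmin hr
  rw [sum_mul_edgeDiv hW, sum_mul_edgeDiv hW] at key
  linarith

lemma primalObj_add_edgeDiv_lt {W : ℕ} (hW : 1 ≤ W) {f : Fin W → ℝ}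
    {w s : Fin (W - 1) → ℝ} (hw : ∀ x, 0 ≤ w x) (hs : ∀ x, |s x| ≤ w x)
    (hmin : ∀ r : Fin (W - 1) → ℝ, (∀ x, |r x| ≤ w x) → dualObj f s ≤ dualObj f r)
    {z : Fin W → ℝ} (hne : z ≠ fun x => f x + edgeDiv s x) :
    primalObj f w (fun x => f x + edgeDiv s x) < primalObj f w z := by
  have tight := sum_weight_mul_abs_fdiff_le hW hw hs hmin
  set y : Fin W → ℝ := fun x => f x + edgeDiv s x with hy
  have bound : ∑ x, s x * fdiff z x ≤ ∑ x, w x * |fdiff z x| :=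
    Finset.sum_le_sum fun x _ => by
      calc s x * fdiff z x ≤ |s x| * |fdiff z x| := by
            rw [← abs_mul]
            exact le_abs_self _
        _ ≤ w x * |fdiff z x| := mul_le_mul_of_nonneg_right (hs x) (abs_nonneg _)
  have pos : 0 < ∑ x, (z x - y x) ^ 2 := by
    obtain ⟨x, hx⟩ := Function.ne_iff.1 hne
    exact Finset.sum_pos' (fun x _ => sq_nonneg _)
      ⟨x, Finset.mem_univ x, sq_pos_of_ne_zero (sub_ne_zero.2 hx)⟩
  have expand : 1 / 2 * ∑ x, (z x - f x) ^ 2 - 1 / 2 * ∑ x, (y x - f x) ^ 2 =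
      1 / 2 * ∑ x, (z x - y x) ^ 2 + (∑ x, z x * edgeDiv s x - ∑ x, y x * edgeDiv s x) := by
    simp only [Finset.mul_sum, ← Finset.sum_sub_distrib, ← Finset.sum_add_distrib, hy]
    exact Finset.sum_congr rfl fun x _ => by ring
  rw [sum_mul_edgeDiv hW, sum_mul_edgeDiv hW] at expand
  unfold primalObj
  linarith

theorem stmt_7 (W : ℕ) (hW : 1 ≤ W) (f : Fin W → ℝ)
    (w : Fin (W - 1) → ℝ) (hw : ∀ x, 0 ≤ w x) :
    ∃ sstar : Fin (W - 1) → ℝ,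
      -- s* is feasible
      (∀ x, |sstar x| ≤ w x) ∧
      -- s* minimizes the dual objective over the box C
      (∀ s : Fin (W - 1) → ℝ, (∀ x, |s x| ≤ w x) → dualObj f sstar ≤ dualObj f s) ∧
      -- the recovered primal signal z* = f − Dᵀs* is the unique global
      -- minimizer of the primal objective
      (∀ z : Fin W → ℝ,
        z ≠ (fun x : Fin W => f x + sExt sstar (x.val : ℤ) - sExt sstar ((x.val : ℤ) - 1)) →
        primalObj f w
            (fun x : Fin W => f x + sExt sstar (x.val : ℤ) - sExt sstar ((x.val : ℤ) - 1)) <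
          primalObj f w z) := by
  obtain ⟨s, hs, hmin⟩ := exists_dualObj_minimizer f w hw
  refine ⟨s, hs, hmin, fun z hz => ?_⟩
  simp only [add_sub_assoc] at hz ⊢
  exact primalObj_add_edgeDiv_lt hW hw hs hmin hz
end

section
/- Let H, W be positive integers, f : Fin H × Fin W → ℝ an input image, λ ≥ 0, σ > 0, and nonnegative weights w₁ (on horizontal edges) and w₂ (on vertical edges). Define the non-convex objective E(u) = Σ_p (u_p − f_p)² + λ [ Σ_{horizontal edges e} w₁(e)·σ(1 − exp(−((D₁u)(e))²/σ)) + Σ_{vertical edges e} w₂(e)·σ(1 − exp(−((D₂u)(e))²/σ)) ]. Given any u^k : Fin H × Fin W → ℝ, set the IRLS weights a₁(e) = w₁(e)·exp(−((D₁u^k)(e))²/σ) and a₂(e) = w₂(e)·exp(−((D₂u^k)(e))²/σ), and let u^{k+1} be any global minimizer of the quadratic surrogate S(u) = Σ_p (u_p − f_p)² + λ [ Σ_e a₁(e)((D₁u)(e))² + Σ_e a₂(e)((D₂u)(e))² ]. Then E(u^{k+1}) ≤ E(u^k). -/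
/-- The potential `τ ↦ σ (1 - exp (-τ² / σ))` is, as a function of `τ²`, concave, so it lies below
its tangent at `b²`. -/
lemma welsch_sub_le {σ : ℝ} (hσ : 0 < σ) (a b : ℝ) :
    σ * (1 - Real.exp (-a ^ 2 / σ)) - σ * (1 - Real.exp (-b ^ 2 / σ)) ≤
      Real.exp (-b ^ 2 / σ) * a ^ 2 - Real.exp (-b ^ 2 / σ) * b ^ 2 := by
  have hexp : Real.exp (-a ^ 2 / σ) =
      Real.exp (-b ^ 2 / σ) * Real.exp ((b ^ 2 - a ^ 2) / σ) := by
    rw [← Real.exp_add]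
    ring_nf
  have htangent : σ + (b ^ 2 - a ^ 2) ≤ σ * Real.exp ((b ^ 2 - a ^ 2) / σ) :=
    calc σ + (b ^ 2 - a ^ 2) = σ * ((b ^ 2 - a ^ 2) / σ + 1) := by field_simp; ring
      _ ≤ σ * Real.exp ((b ^ 2 - a ^ 2) / σ) :=
        mul_le_mul_of_nonneg_left (Real.add_one_le_exp _) hσ.le
  have h := mul_le_mul_of_nonneg_left htangent (Real.exp_pos (-b ^ 2 / σ)).le
  rw [hexp]
  linarith

lemma sum_welsch_sub_le {ι : Type*} [Fintype ι] {σ : ℝ} (hσ : 0 < σ) {w : ι → ℝ}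
    (hw : ∀ e, 0 ≤ w e) (a b : ι → ℝ) :
    (∑ e, w e * (σ * (1 - Real.exp (-(a e) ^ 2 / σ)))) -
        ∑ e, w e * (σ * (1 - Real.exp (-(b e) ^ 2 / σ))) ≤
      (∑ e, (w e * Real.exp (-(b e) ^ 2 / σ)) * (a e) ^ 2) -
        ∑ e, (w e * Real.exp (-(b e) ^ 2 / σ)) * (b e) ^ 2 := by
  rw [← Finset.sum_sub_distrib, ← Finset.sum_sub_distrib]
  refine Finset.sum_le_sum fun e _ => ?_
  have h := mul_le_mul_of_nonneg_left (welsch_sub_le hσ (a e) (b e)) (hw e)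
  linarith


open Finset

/-- Horizontal forward difference of an image. -/
def D1 {H W : ℕ} (u : Fin H × Fin W → ℝ) (e : Fin H × Fin (W - 1)) : ℝ :=
  u (e.1, ⟨e.2.val + 1, by have := e.2.isLt; omega⟩) -
    u (e.1, ⟨e.2.val, by have := e.2.isLt; omega⟩)

/-- Vertical forward difference of an image. -/
def D2 {H W : ℕ} (u : Fin H × Fin W → ℝ) (e : Fin (H - 1) × Fin W) : ℝ :=
  u (⟨e.1.val + 1, by have := e.1.isLt; omega⟩, e.2) -
    u (⟨e.1.val, by have := e.1.isLt; omega⟩, e.2)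

/-- The non-convex objective with potential `ψ(τ) = σ(1 − exp(−τ²/σ))`. -/
noncomputable def Eexp {H W : ℕ} (f : Fin H × Fin W → ℝ) (lam σ : ℝ)
    (w1 : Fin H × Fin (W - 1) → ℝ) (w2 : Fin (H - 1) × Fin W → ℝ)
    (u : Fin H × Fin W → ℝ) : ℝ :=
  (∑ p, (u p - f p) ^ 2) +
    lam * ((∑ e, w1 e * (σ * (1 - Real.exp (-(D1 u e) ^ 2 / σ)))) +
           (∑ e, w2 e * (σ * (1 - Real.exp (-(D2 u e) ^ 2 / σ)))))

/-- The IRLS quadratic surrogate built at the current iterate `uk`. -/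
noncomputable def Sirls {H W : ℕ} (f : Fin H × Fin W → ℝ) (lam σ : ℝ)
    (w1 : Fin H × Fin (W - 1) → ℝ) (w2 : Fin (H - 1) × Fin W → ℝ)
    (uk : Fin H × Fin W → ℝ) (u : Fin H × Fin W → ℝ) : ℝ :=
  (∑ p, (u p - f p) ^ 2) +
    lam * ((∑ e, (w1 e * Real.exp (-(D1 uk e) ^ 2 / σ)) * (D1 u e) ^ 2) +
           (∑ e, (w2 e * Real.exp (-(D2 uk e) ^ 2 / σ)) * (D2 u e) ^ 2))

theorem stmt_11 (H W : ℕ) (hH : 0 < H) (hW : 0 < W)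
    (f : Fin H × Fin W → ℝ) (lam σ : ℝ) (hlam : 0 ≤ lam) (hσ : 0 < σ)
    (w1 : Fin H × Fin (W - 1) → ℝ) (w2 : Fin (H - 1) × Fin W → ℝ)
    (hw1 : ∀ e, 0 ≤ w1 e) (hw2 : ∀ e, 0 ≤ w2 e)
    (uk uk1 : Fin H × Fin W → ℝ)
    (hmin : ∀ u : Fin H × Fin W → ℝ,
      Sirls f lam σ w1 w2 uk uk1 ≤ Sirls f lam σ w1 w2 uk u) :
    Eexp f lam σ w1 w2 uk1 ≤ Eexp f lam σ w1 w2 uk := by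
  have h := mul_le_mul_of_nonneg_left
    (add_le_add (sum_welsch_sub_le hσ hw1 (D1 uk1) (D1 uk))
      (sum_welsch_sub_le hσ hw2 (D2 uk1) (D2 uk))) hlam
  have hS := hmin uk
  unfold Sirls at hS
  unfold Eexp
  linarith
end

section
/- Let H, W be positive integers, f : Fin H × Fin W → ℝ an input image, λ ≥ 0, and nonnegative weights w₁ (on horizontal edges) and w₂ (on vertical edges). Define the non-convex objective E(u) = Σ_p (u_p − f_p)² + λ [ Σ_{horizontal edges e} w₁(e)·log(1 + |(D₁u)(e)|) + Σ_{vertical edges e} w₂(e)·log(1 + |(D₂u)(e)|) ]. Given any u^k : Fin H × Fin W → ℝ, set the IRL1 weights b₁(e) = w₁(e)/(1 + |(D₁u^k)(e)|) and b₂(e) = w₂(e)/(1 + |(D₂u^k)(e)|), and let u^{k+1} be any global minimizer of the weighted total variation surrogate S(u) = Σ_p (u_p − f_p)² + λ [ Σ_e b₁(e)|(D₁u)(e)| + Σ_e b₂(e)|(D₂u)(e)| ]. Then E(u^{k+1}) ≤ E(u^k). -/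
open Finset

/-- The non-convex objective with potential `ψ(τ) = log(1 + |τ|)`. -/
noncomputable def Elog {H W : ℕ} (f : Fin H × Fin W → ℝ) (lam : ℝ)
    (w1 : Fin H × Fin (W - 1) → ℝ) (w2 : Fin (H - 1) × Fin W → ℝ)
    (u : Fin H × Fin W → ℝ) : ℝ :=
  (∑ p, (u p - f p) ^ 2) +
    lam * ((∑ e, w1 e * Real.log (1 + |D1 u e|)) +
           (∑ e, w2 e * Real.log (1 + |D2 u e|)))

/-- The IRL1 weighted total variation surrogate built at the current iterate `uk`. -/
noncomputable def Sirl1 {H W : ℕ} (f : Fin H × Fin W → ℝ) (lam : ℝ)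
    (w1 : Fin H × Fin (W - 1) → ℝ) (w2 : Fin (H - 1) × Fin W → ℝ)
    (uk : Fin H × Fin W → ℝ) (u : Fin H × Fin W → ℝ) : ℝ :=
  (∑ p, (u p - f p) ^ 2) +
    lam * ((∑ e, (w1 e / (1 + |D1 uk e|)) * |D1 u e|) +
           (∑ e, (w2 e / (1 + |D2 uk e|)) * |D2 u e|))

theorem log_one_add_sub_le {a t : ℝ} (ha : 0 ≤ a) (ht : 0 ≤ t) :
    Real.log (1 + t) - Real.log (1 + a) ≤ (t - a) / (1 + a) := by
  have ha' : 0 < 1 + a := by positivity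
  have ht' : 0 < 1 + t := by positivity
  rw [← Real.log_div ht'.ne' ha'.ne']
  refine (Real.log_le_sub_one_of_pos (div_pos ht' ha')).trans_eq ?_
  field_simp
  ring

theorem sum_log_sub_le_sum_reweighted_sub {ι : Type*} [Fintype ι] (w a t : ι → ℝ)
    (hw : ∀ e, 0 ≤ w e) :
    (∑ e, w e * Real.log (1 + |t e|)) - ∑ e, w e * Real.log (1 + |a e|) ≤
      (∑ e, w e / (1 + |a e|) * |t e|) - ∑ e, w e / (1 + |a e|) * |a e| := by
  rw [← Finset.sum_sub_distrib, ← Finset.sum_sub_distrib]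
  refine Finset.sum_le_sum fun e _ => ?_
  calc w e * Real.log (1 + |t e|) - w e * Real.log (1 + |a e|)
      = w e * (Real.log (1 + |t e|) - Real.log (1 + |a e|)) := by ring
    _ ≤ w e * ((|t e| - |a e|) / (1 + |a e|)) :=
        mul_le_mul_of_nonneg_left (log_one_add_sub_le (abs_nonneg _) (abs_nonneg _)) (hw e)
    _ = w e / (1 + |a e|) * |t e| - w e / (1 + |a e|) * |a e| := by ring

theorem stmt_12 (H W : ℕ) (hH : 0 < H) (hW : 0 < W)
    (f : Fin H × Fin W → ℝ) (lam : ℝ) (hlam : 0 ≤ lam)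
    (w1 : Fin H × Fin (W - 1) → ℝ) (w2 : Fin (H - 1) × Fin W → ℝ)
    (hw1 : ∀ e, 0 ≤ w1 e) (hw2 : ∀ e, 0 ≤ w2 e)
    (uk uk1 : Fin H × Fin W → ℝ)
    (hmin : ∀ u : Fin H × Fin W → ℝ,
      Sirl1 f lam w1 w2 uk uk1 ≤ Sirl1 f lam w1 w2 uk u) :
    Elog f lam w1 w2 uk1 ≤ Elog f lam w1 w2 uk := by
  have h := hmin uk
  have hsum := mul_le_mul_of_nonneg_left
    (add_le_add (sum_log_sub_le_sum_reweighted_sub w1 (D1 uk) (D1 uk1) hw1)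
      (sum_log_sub_le_sum_reweighted_sub w2 (D2 uk) (D2 uk1) hw2)) hlam
  unfold Sirl1 at h
  unfold Elog
  linarith
end
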